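/- There is a constant c > 0 (depending only on sup_n m_n) such that sup_{n≥1} ∫_{G_m} |K_n(x)| dμ(x) ≤ c; that is, the Vilenkin–Fejér kernels are uniformly bounded in L¹(G_m). -/

import Mathlib

open MeasureTheory Filter
open scoped ENNReal NNReal Real BigOperators

noncomputable section

namespace Vilenkin

instance (k : ℕ) : MeasurableSpace (ZMod k) := ⊤

/-- The Vilenkin group: the product of the cyclic groups `ZMod (m n)`. -/
abbrev G (m : ℕ → ℕ) : Type := ∀ n : ℕ, ZMod (m n)

variable (m : ℕ → ℕ)

/-- The generalized powers `M_0 = 1`, `M_{n+1} = m_n M_n`. -/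
def Mprod : ℕ → ℕ
  | 0 => 1
  | n + 1 => m n * Mprod n

/-- The `k`-th digit of `n` in the base-`M` expansion `n = Σ_k n_k M_k`. -/
def digit (n k : ℕ) : ℕ := (n / Mprod m k) % m k

/-- `⟨n⟩`, the smallest index of a nonzero digit. -/
def lowIdx (n : ℕ) : ℕ := sInf {j | digit m n j ≠ 0}

/-- `|n|`, the largest index of a nonzero digit. -/
def highIdx (n : ℕ) : ℕ := sSup {j | digit m n j ≠ 0}

/-- Generalized Rademacher functions `r_k(x) = exp(2πi x_k / m_k)`. -/
def rad (k : ℕ) (x : G m) : ℂ :=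
  Complex.exp (2 * Real.pi * Complex.I * ((x k).val : ℂ) / (m k : ℂ))

/-- The Vilenkin system `ψ_n = ∏_k r_k^{n_k}`. -/
def psi (n : ℕ) (x : G m) : ℂ :=
  ∏ k ∈ Finset.range (n + 1), rad m k x ^ digit m n k

/-- Dirichlet kernels `D_n = Σ_{k<n} ψ_k`. -/
def Dker (n : ℕ) (x : G m) : ℂ := ∑ k ∈ Finset.range n, psi m k x

/-- Fejér kernels `K_n = (1/n) Σ_{k<n} D_k`. -/
def Kker (n : ℕ) (x : G m) : ℂ := (n : ℂ)⁻¹ * ∑ k ∈ Finset.range n, Dker m k x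

/-- The cylinder `I_n(x)`. -/
def cylinder (n : ℕ) (x : G m) : Set (G m) := {y | ∀ j, j < n → y j = x j}

/-- `e_t`: the element with `t`-th coordinate `1` and all others `0`. -/
def eVec (t : ℕ) : G m := fun j => if j = t then 1 else 0

/-- The filtration `F_n` generated by the cylinders of level `n`. -/
def filtr (n : ℕ) : MeasurableSpace (G m) :=
  MeasurableSpace.comap (fun x (j : Fin n) => x j.val) inferInstance

/-- The normalized Haar measure on `G_m`: the probability measure giving each cylinder
`I_n(x)` measure `1/M_n`. -/
def IsVilenkinMeasure (μ : Measure (G m)) : Prop :=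
  IsProbabilityMeasure μ ∧ ∀ n x, μ (cylinder m n x) = (Mprod m n : ℝ≥0∞)⁻¹

/-- Martingales with respect to the filtration `(F_n)`. -/
def IsMartingale (μ : Measure (G m)) (f : ℕ → G m → ℂ) : Prop :=
  (∀ n, Integrable (f n) μ) ∧
  (∀ n, Measurable[filtr m n] (f n)) ∧
  (∀ n, ∀ s : Set (G m), MeasurableSet[filtr m n] s →
    ∫ x in s, f (n + 1) x ∂μ = ∫ x in s, f n x ∂μ)

/-- The maximal function `f* = sup_n |f^{(n)}|` (with values in `ℝ≥0∞`). -/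
def maximalFn (f : ℕ → G m → ℂ) (x : G m) : ℝ≥0∞ := ⨆ n, (‖f n x‖₊ : ℝ≥0∞)

/-- The martingale Hardy space quasi-norm `‖f‖_{H_p} = ‖f*‖_{L_p}`. -/
def hardyNorm (p : ℝ) (μ : Measure (G m)) (f : ℕ → G m → ℂ) : ℝ≥0∞ :=
  (∫⁻ x, maximalFn m f x ^ p ∂μ) ^ (1 / p)

/-- Vilenkin-Fourier coefficients of an integrable function. -/
def fourierCoeff (μ : Measure (G m)) (g : G m → ℂ) (k : ℕ) : ℂ :=
  ∫ x, g x * (starRingEnd ℂ) (psi m k x) ∂μ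

/-- Partial sums `S_n g` of the Vilenkin-Fourier series of a function. -/
def SFun (μ : Measure (G m)) (g : G m → ℂ) (n : ℕ) (x : G m) : ℂ :=
  ∑ k ∈ Finset.range n, fourierCoeff m μ g k * psi m k x

/-- Fejér means `σ_n g` of a function. -/
def sigmaFun (μ : Measure (G m)) (g : G m → ℂ) (n : ℕ) (x : G m) : ℂ :=
  (n : ℂ)⁻¹ * ∑ k ∈ Finset.range n, SFun m μ g k x

/-- Vilenkin-Fourier coefficients of a martingale:
`f̂(i) = lim_k ∫ f^{(k)} ψ̄_i dμ`. -/
def martCoeff (μ : Measure (G m)) (f : ℕ → G m → ℂ) (i : ℕ) : ℂ :=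
  limUnder atTop fun k => ∫ x, f k x * (starRingEnd ℂ) (psi m i x) ∂μ

/-- Partial sums `S_n f` of the Vilenkin-Fourier series of a martingale. -/
def SMart (μ : Measure (G m)) (f : ℕ → G m → ℂ) (n : ℕ) (x : G m) : ℂ :=
  ∑ k ∈ Finset.range n, martCoeff m μ f k * psi m k x

/-- Fejér means `σ_n f` of a martingale. -/
def sigmaMart (μ : Measure (G m)) (f : ℕ → G m → ℂ) (n : ℕ) (x : G m) : ℂ :=
  (n : ℂ)⁻¹ * ∑ k ∈ Finset.range n, SMart m μ f k x

/-- The weak `L_p` quasi-norm `‖g‖_{L_{p,∞}} = (sup_λ λ^p μ(|g|>λ))^{1/p}`. -/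
def weakNorm (p : ℝ) (μ : Measure (G m)) (g : G m → ℂ) : ℝ≥0∞ :=
  (⨆ lam : ℝ≥0, (lam : ℝ≥0∞) ^ p * μ {x | (lam : ℝ) < ‖g x‖}) ^ (1 / p)

/-- A `p`-atom with prescribed support interval `I_N(x₀)`. -/
def IsPAtomAt (p : ℝ) (μ : Measure (G m)) (N : ℕ) (x₀ : G m) (a : G m → ℂ) : Prop :=
  Measurable a ∧ Function.support a ⊆ cylinder m N x₀ ∧
    (∫ x in cylinder m N x₀, a x ∂μ) = 0 ∧
    eLpNorm a ⊤ μ ≤ μ (cylinder m N x₀) ^ (-(1 / p))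

/-- A `p`-atom. -/
def IsPAtom (p : ℝ) (μ : Measure (G m)) (a : G m → ℂ) : Prop :=
  ∃ N x₀, IsPAtomAt m p μ N x₀ a

/-- The sets `I_N^{i,j}` for `i < j ≤ N`. -/
def IsetIJ (N i j : ℕ) : Set (G m) :=
  if j < N then
    {x | (∀ l, l < i → x l = 0) ∧ x i ≠ 0 ∧ (∀ l, i < l → l < j → x l = 0) ∧ x j ≠ 0}
  else
    {x | (∀ l, l < i → x l = 0) ∧ x i ≠ 0 ∧ (∀ l, i < l → l < N → x l = 0)}

lemma one_le_Mprod (hm : ∀ n, 2 ≤ m n) (A : ℕ) : 1 ≤ Mprod m A := by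
  induction A with
  | zero => exact le_rfl
  | succ A ih => exact Nat.mul_pos (by linarith [hm A]) ih

lemma two_mul_Mprod_le (hm : ∀ n, 2 ≤ m n) (A : ℕ) : 2 * Mprod m A ≤ Mprod m (A + 1) :=
  Nat.mul_le_mul_right _ (hm A)

lemma lt_Mprod (hm : ∀ n, 2 ≤ m n) (A : ℕ) : A < Mprod m A := by
  induction A with
  | zero => exact Nat.one_pos
  | succ A ih => linarith [two_mul_Mprod_le m hm A]

lemma Mprod_dvd_of_le {i j : ℕ} (h : i ≤ j) : Mprod m i ∣ Mprod m j := by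
  induction j, h using Nat.le_induction with
  | base => exact dvd_rfl
  | succ j _ ih => exact ih.mul_left _

lemma Mprod_le_of_le (hm : ∀ n, 2 ≤ m n) {i j : ℕ} (h : i ≤ j) : Mprod m i ≤ Mprod m j :=
  Nat.le_of_dvd (one_le_Mprod m hm j) (Mprod_dvd_of_le m h)

lemma sum_Mprod_succ_le (hm : ∀ n, 2 ≤ m n) (A : ℕ) :
    ∑ k ∈ Finset.range A, Mprod m (k + 1) ≤ 2 * Mprod m A := by
  induction A with
  | zero => simp
  | succ A ih =>
    rw [Finset.sum_range_succ]
    linarith [two_mul_Mprod_le m hm A]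

lemma digit_eq_zero (hm : ∀ n, 2 ≤ m n) {n N k : ℕ} (hn : n < Mprod m N) (hk : N ≤ k) :
    digit m n k = 0 := by
  rw [digit, Nat.div_eq_of_lt (hn.trans_le (Mprod_le_of_le m hm hk)), Nat.zero_mod]

/-- In the definition of `ψ_n`, the product may be taken over any initial range of indices that
contains all nonzero digits of `n`. -/
lemma psi_eq_prod (hm : ∀ n, 2 ≤ m n) {n N : ℕ} (hn : n < Mprod m N) (x : G m) :
    psi m n x = ∏ k ∈ Finset.range N, rad m k x ^ digit m n k := by
  have hn' : n < Mprod m (n + 1) := (Nat.lt_succ_self n).trans (lt_Mprod m hm _)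
  have extend : ∀ {N N' : ℕ}, n < Mprod m N → N ≤ N' →
      ∏ k ∈ Finset.range N, rad m k x ^ digit m n k
        = ∏ k ∈ Finset.range N', rad m k x ^ digit m n k := by
    intro N N' h hN
    refine Finset.prod_subset (Finset.range_mono hN) fun k _ hk => ?_
    rw [digit_eq_zero m hm h (by simpa using hk), pow_zero]
  rw [psi, extend hn' (le_max_left (n + 1) N), extend hn (le_max_right (n + 1) N)]

lemma psi_block (hm : ∀ n, 2 ≤ m n) {A t j : ℕ} (ht : t < m A) (hj : j < Mprod m A) (x : G m) :
    psi m (t * Mprod m A + j) x = rad m A x ^ t * psi m j x := by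
  have hlt : t * Mprod m A + j < Mprod m (A + 1) := by
    calc t * Mprod m A + j < (t + 1) * Mprod m A := by linarith
      _ ≤ Mprod m (A + 1) := Nat.mul_le_mul_right _ ht
  rw [psi_eq_prod m hm hlt, psi_eq_prod m hm hj, Finset.prod_range_succ, mul_comm]
  congr 1
  · rw [digit, mul_comm t, Nat.mul_add_div (one_le_Mprod m hm A), Nat.div_eq_of_lt hj, add_zero,
      Nat.mod_eq_of_lt ht]
  · refine Finset.prod_congr rfl fun k hk => ?_
    obtain ⟨q, hq⟩ := Mprod_dvd_of_le m (Nat.succ_le_of_lt (Finset.mem_range.mp hk))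
    have hdig : digit m (t * Mprod m A + j) k = digit m j k := by
      have h : t * Mprod m A + j = Mprod m k * (m k * (q * t)) + j := by
        rw [hq, Mprod]; ring
      rw [digit, digit, h, Nat.mul_add_div (one_le_Mprod m hm k), Nat.mul_add_mod]
    rw [hdig]

/-- The partial sums `Σ_{k<n} D_k = n K_n`. -/
def dirichletSum (n : ℕ) (x : G m) : ℂ := ∑ k ∈ Finset.range n, Dker m k x

lemma Dker_mul_Mprod (hm : ∀ n, 2 ≤ m n) {A t : ℕ} (ht : t ≤ m A) (x : G m) :
    Dker m (t * Mprod m A) x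
      = (∑ i ∈ Finset.range t, rad m A x ^ i) * Dker m (Mprod m A) x := by
  induction t with
  | zero => simp [Dker]
  | succ t ih =>
    rw [Finset.sum_range_succ, add_mul _ (rad m A x ^ t), ← ih (by omega), add_one_mul, Dker,
      Finset.sum_range_add]
    congr 1
    rw [Dker, Finset.mul_sum]
    exact Finset.sum_congr rfl fun j hj => psi_block m hm ht (Finset.mem_range.mp hj) x

lemma Dker_block (hm : ∀ n, 2 ≤ m n) {A t k : ℕ} (ht : t < m A) (hk : k ≤ Mprod m A) (x : G m) :
    Dker m (t * Mprod m A + k) x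
      = (∑ i ∈ Finset.range t, rad m A x ^ i) * Dker m (Mprod m A) x
        + rad m A x ^ t * Dker m k x := by
  rw [← Dker_mul_Mprod m hm ht.le, Dker, Finset.sum_range_add]
  congr 1
  rw [Dker, Finset.mul_sum]
  exact Finset.sum_congr rfl fun j hj =>
    psi_block m hm ht ((Finset.mem_range.mp hj).trans_le hk) x

lemma dirichletSum_block (hm : ∀ n, 2 ≤ m n) {A t k : ℕ} (ht : t < m A) (hk : k ≤ Mprod m A)
    (x : G m) :
    dirichletSum m (t * Mprod m A + k) x
      = dirichletSum m (t * Mprod m A) x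
        + (k * ((∑ i ∈ Finset.range t, rad m A x ^ i) * Dker m (Mprod m A) x)
          + rad m A x ^ t * dirichletSum m k x) := by
  rw [dirichletSum, Finset.sum_range_add]
  congr 1
  rw [Finset.sum_congr rfl fun j hj =>
    Dker_block m hm ht ((Finset.mem_range.mp hj).le.trans hk) x, Finset.sum_add_distrib,
    Finset.sum_const, ← Finset.mul_sum, dirichletSum, Finset.card_range, nsmul_eq_mul]

lemma dirichletSum_mul_Mprod (hm : ∀ n, 2 ≤ m n) {A t : ℕ} (ht : t ≤ m A) (x : G m) :
    dirichletSum m (t * Mprod m A) x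
      = Mprod m A * ((∑ i ∈ Finset.range t, ∑ l ∈ Finset.range i, rad m A x ^ l)
          * Dker m (Mprod m A) x)
        + (∑ i ∈ Finset.range t, rad m A x ^ i) * dirichletSum m (Mprod m A) x := by
  induction t with
  | zero => simp [dirichletSum]
  | succ t ih =>
    rw [add_one_mul, dirichletSum_block m hm ht le_rfl, ih (by omega), Finset.sum_range_succ,
      Finset.sum_range_succ]
    ring

lemma rad_eq_pow (k : ℕ) (x : G m) :
    rad m k x = Complex.exp (2 * π * Complex.I / m k) ^ (x k).val := by
  rw [rad, ← Complex.exp_nat_mul]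
  congr 1
  ring

lemma norm_rad (k : ℕ) (x : G m) : ‖rad m k x‖ = 1 := by
  have h : (2 * Real.pi * Complex.I * ((x k).val : ℂ) / (m k : ℂ))
      = ((2 * Real.pi * (x k).val / m k : ℝ) : ℂ) * Complex.I := by
    push_cast; ring
  rw [rad, h, Complex.norm_exp_ofReal_mul_I]

lemma sum_rad_pow (hm : ∀ n, 2 ≤ m n) (A : ℕ) (x : G m) :
    ∑ i ∈ Finset.range (m A), rad m A x ^ i = if x A = 0 then (m A : ℂ) else 0 := by
  have : NeZero (m A) := ⟨by linarith [hm A]⟩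
  have hprim := Complex.isPrimitiveRoot_exp (m A) (NeZero.ne _)
  split_ifs with h
  · simp [rad, h]
  · have hne : rad m A x ≠ 1 := by
      rw [rad_eq_pow, Ne, hprim.pow_eq_one_iff_dvd]
      intro hdvd
      exact h ((ZMod.val_eq_zero _).mp (Nat.eq_zero_of_dvd_of_lt hdvd (ZMod.val_lt _)))
    rw [geom_sum_eq hne, rad_eq_pow, pow_right_comm, hprim.pow_eq_one]
    simp

lemma enorm_sum_rad_pow_le (A t : ℕ) (x : G m) :
    ‖∑ i ∈ Finset.range t, rad m A x ^ i‖ₑ ≤ t := by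
  refine (enorm_sum_le _ _).trans_eq ?_
  simp [← ofReal_norm, norm_rad]

lemma enorm_sum_sum_rad_pow_le (A t : ℕ) (x : G m) :
    ‖∑ i ∈ Finset.range t, ∑ l ∈ Finset.range i, rad m A x ^ l‖ₑ ≤ (t * t : ℕ) := by
  calc ‖∑ i ∈ Finset.range t, ∑ l ∈ Finset.range i, rad m A x ^ l‖ₑ
      ≤ ∑ i ∈ Finset.range t, (t : ℝ≥0∞) :=
        (enorm_sum_le _ _).trans <| Finset.sum_le_sum fun i hi =>
          (enorm_sum_rad_pow_le m A i x).trans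
            (Nat.cast_le.mpr (Finset.mem_range.mp hi).le)
    _ = (t * t : ℕ) := by simp

/-- The points whose coordinates of index below `A` vanish, except possibly the `k`-th one. -/
def nearZero (A k : ℕ) : Set (G m) := {x | ∀ l, l < A → l ≠ k → x l = 0}

lemma Dker_Mprod (hm : ∀ n, 2 ≤ m n) (A : ℕ) (x : G m) :
    Dker m (Mprod m A) x = (nearZero m A A).indicator (fun _ => (Mprod m A : ℂ)) x := by
  have hmem : ∀ A, x ∈ nearZero m A A ↔ ∀ l, l < A → x l = 0 := fun A =>
    forall₂_congr fun l hl => by simp [hl.ne]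
  classical
  simp only [Set.indicator_apply, hmem]
  induction A with
  | zero => simp [Dker, Mprod, psi, digit]
  | succ A ih =>
    have h := Dker_mul_Mprod m hm (le_refl (m A)) x
    rw [sum_rad_pow m hm, ih] at h
    rw [Mprod, h]
    simp only [Nat.forall_lt_succ_right]
    by_cases hA : x A = 0 <;> by_cases hl : ∀ l, l < A → x l = 0 <;> simp [hA, hl]

lemma enorm_dirichletSum_Mprod_le (hm : ∀ n, 2 ≤ m n) (A : ℕ) (x : G m) :
    ‖dirichletSum m (Mprod m A) x‖ₑ
      ≤ ∑ k ∈ Finset.range A,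
        (nearZero m A k).indicator (fun _ => (Mprod m (k + 1) * Mprod m A : ℝ≥0∞)) x := by
  induction A with
  | zero => simp [dirichletSum, Mprod, Dker]
  | succ A ih =>
    have h := dirichletSum_mul_Mprod m hm (le_refl (m A)) x
    rw [Mprod, h, Finset.sum_range_succ, add_comm]
    refine (enorm_add_le _ _).trans (add_le_add ?_ ?_)
    · rw [sum_rad_pow m hm]
      split_ifs with hA
      · rw [enorm_mul]
        refine (mul_le_mul_right ih _).trans_eq ?_
        rw [Finset.mul_sum]
        refine Finset.sum_congr rfl fun k hk => ?_
        have hkA : A ≠ k := (Finset.mem_range.mp hk).ne'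
        have hiff : x ∈ nearZero m (A + 1) k ↔ x ∈ nearZero m A k := by
          simp only [nearZero, Set.mem_ofPred_eq, Nat.forall_lt_succ_right]
          simp [hA]
        classical
        simp only [Set.indicator_apply, hiff]
        split_ifs
        · rw [← ofReal_norm, Complex.norm_natCast, ENNReal.ofReal_natCast]
          push_cast
          ring
        · simp
      · simp
    · rw [Dker_Mprod m hm]
      have hiff : x ∈ nearZero m (A + 1) A ↔ x ∈ nearZero m A A := by
        simp only [nearZero, Set.mem_ofPred_eq, Nat.forall_lt_succ_right]
        simp
      classical
      simp only [Set.indicator_apply, hiff]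
      split_ifs
      · rw [enorm_mul, enorm_mul, ← ofReal_norm (Mprod m A : ℂ), Complex.norm_natCast,
          ENNReal.ofReal_natCast]
        refine (mul_le_mul_right (mul_le_mul_left (enorm_sum_sum_rad_pow_le m A _ x) _) _).trans_eq
          ?_
        rw [Mprod]
        push_cast
        ring
      · simp

lemma measurable_psi (n : ℕ) : Measurable (psi m n) := by
  refine Finset.measurable_fun_prod _ fun k _ => Measurable.pow_const ?_ _
  exact (measurable_from_top (f := fun a : ZMod (m k) =>
    Complex.exp (2 * Real.pi * Complex.I * (a.val : ℂ) / (m k : ℂ)))).comp (measurable_pi_apply k)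

lemma measurable_Dker (n : ℕ) : Measurable (Dker m n) :=
  Finset.measurable_fun_sum _ fun _ _ => measurable_psi m _

lemma measurable_dirichletSum (n : ℕ) : Measurable (dirichletSum m n) :=
  Finset.measurable_fun_sum _ fun _ _ => measurable_Dker m _

lemma measurableSet_nearZero (A k : ℕ) : MeasurableSet (nearZero m A k) := by
  simp only [nearZero, Set.ofPred_forall]
  refine .iInter fun l => .iInter fun _ => .iInter fun _ => ?_
  have h : MeasurableSet ({0} : Set (ZMod (m l))) := trivial
  exact (measurable_pi_apply (X := fun n => ZMod (m n)) l) h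

lemma nearZero_self (A : ℕ) : nearZero m A A = cylinder m A 0 :=
  Set.ext fun x => forall₂_congr fun l hl => by simp [hl.ne]

variable {μ : Measure (G m)}

lemma Mprod_mul_measure_cylinder (hm : ∀ n, 2 ≤ m n) (hμ : IsVilenkinMeasure m μ) (A : ℕ)
    (x : G m) : (Mprod m A : ℝ≥0∞) * μ (cylinder m A x) = 1 := by
  rw [hμ.2]
  exact ENNReal.mul_inv_cancel (by exact_mod_cast (Nat.pos_iff_ne_zero.mp (one_le_Mprod m hm A)))
    (ENNReal.natCast_ne_top _)

lemma Mprod_mul_measure_nearZero_le (hm : ∀ n, 2 ≤ m n) (hμ : IsVilenkinMeasure m μ) (A k : ℕ) :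
    (Mprod m A : ℝ≥0∞) * μ (nearZero m A k) ≤ m k := by
  have : NeZero (m k) := ⟨by linarith [hm k]⟩
  have hsub : nearZero m A k ⊆ ⋃ v : ZMod (m k), cylinder m A (Pi.single k v) := by
    intro x hx
    refine Set.mem_iUnion.mpr ⟨x k, fun l hl => ?_⟩
    by_cases h : l = k
    · subst h; simp
    · simp [hx l hl h, Pi.single_eq_of_ne h]
  calc (Mprod m A : ℝ≥0∞) * μ (nearZero m A k)
      ≤ Mprod m A * ∑ v : ZMod (m k), μ (cylinder m A (Pi.single k v)) := by
        gcongr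
        exact (measure_mono hsub).trans (measure_iUnion_fintype_le _ _)
    _ = m k := by
        simp [Finset.mul_sum, Mprod_mul_measure_cylinder m hm hμ, ZMod.card]

lemma lintegral_enorm_Dker_Mprod_le (hm : ∀ n, 2 ≤ m n) (hμ : IsVilenkinMeasure m μ) (A : ℕ) :
    ∫⁻ x, ‖Dker m (Mprod m A) x‖ₑ ∂μ ≤ 1 := by
  simp only [Dker_Mprod m hm, enorm_indicator_eq_indicator_enorm]
  refine (lintegral_indicator_const_le _ _).trans_eq ?_
  rw [nearZero_self, ← ofReal_norm, Complex.norm_natCast, ENNReal.ofReal_natCast,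
    Mprod_mul_measure_cylinder m hm hμ]

lemma lintegral_enorm_dirichletSum_Mprod_le (hm : ∀ n, 2 ≤ m n) {B : ℕ} (hB : ∀ n, m n ≤ B)
    (hμ : IsVilenkinMeasure m μ) (A : ℕ) :
    ∫⁻ x, ‖dirichletSum m (Mprod m A) x‖ₑ ∂μ ≤ (2 * B * Mprod m A : ℕ) := by
  calc ∫⁻ x, ‖dirichletSum m (Mprod m A) x‖ₑ ∂μ
      ≤ ∫⁻ x, ∑ k ∈ Finset.range A,
          (nearZero m A k).indicator (fun _ => (Mprod m (k + 1) * Mprod m A : ℝ≥0∞)) x ∂μ :=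
        lintegral_mono fun x => enorm_dirichletSum_Mprod_le m hm A x
    _ = ∑ k ∈ Finset.range A, ∫⁻ x,
          (nearZero m A k).indicator (fun _ => (Mprod m (k + 1) * Mprod m A : ℝ≥0∞)) x ∂μ :=
        lintegral_finsetSum _ fun k _ =>
          measurable_const.indicator (measurableSet_nearZero m A k)
    _ ≤ ∑ k ∈ Finset.range A, (Mprod m (k + 1) * B : ℝ≥0∞) := by
        refine Finset.sum_le_sum fun k _ => (lintegral_indicator_const_le _ _).trans ?_
        rw [mul_assoc]
        gcongr
        exact (Mprod_mul_measure_nearZero_le m hm hμ A k).trans (Nat.cast_le.mpr (hB k))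
    _ = ((∑ k ∈ Finset.range A, Mprod m (k + 1)) * B : ℕ) := by
        push_cast
        rw [Finset.sum_mul]
    _ ≤ (2 * B * Mprod m A : ℕ) := by
        refine Nat.cast_le.mpr ((Nat.mul_le_mul_right B (sum_Mprod_succ_le m hm A)).trans_eq ?_)
        ring

lemma enorm_dirichletSum_block_le (hm : ∀ n, 2 ≤ m n) {A t k : ℕ} (ht : t < m A)
    (hk : k ≤ Mprod m A) (x : G m) :
    ‖dirichletSum m (t * Mprod m A + k) x‖ₑ
      ≤ (Mprod m A * (t * t) + k * t : ℕ) * ‖Dker m (Mprod m A) x‖ₑ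
        + (t * ‖dirichletSum m (Mprod m A) x‖ₑ + ‖dirichletSum m k x‖ₑ) := by
  have enorm_natCast : ∀ a : ℕ, ‖(a : ℂ)‖ₑ = a := fun a => by
    rw [← ofReal_norm, Complex.norm_natCast, ENNReal.ofReal_natCast]
  have hrad : ‖rad m A x ^ t‖ₑ = 1 := by
    rw [enorm_pow, ← ofReal_norm, norm_rad, ENNReal.ofReal_one, one_pow]
  rw [dirichletSum_block m hm ht hk, dirichletSum_mul_Mprod m hm ht.le]
  calc _ ≤ Mprod m A * (((t * t : ℕ) : ℝ≥0∞) * ‖Dker m (Mprod m A) x‖ₑ)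
        + t * ‖dirichletSum m (Mprod m A) x‖ₑ
        + (k * (t * ‖Dker m (Mprod m A) x‖ₑ) + 1 * ‖dirichletSum m k x‖ₑ) := by
        refine (enorm_add_le _ _).trans (add_le_add ((enorm_add_le _ _).trans ?_)
          ((enorm_add_le _ _).trans ?_))
        · simp only [enorm_mul, enorm_natCast]
          gcongr
          · exact enorm_sum_sum_rad_pow_le m A t x
          · exact enorm_sum_rad_pow_le m A t x
        · simp only [enorm_mul, enorm_natCast, hrad]
          gcongr
          exact enorm_sum_rad_pow_le m A t x
    _ = _ := by push_cast; ring

lemma lintegral_enorm_dirichletSum_le (hm : ∀ n, 2 ≤ m n) {B : ℕ} (hB : ∀ n, m n ≤ B)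
    (hμ : IsVilenkinMeasure m μ) (n : ℕ) :
    ∫⁻ x, ‖dirichletSum m n x‖ₑ ∂μ ≤ ((3 * B + 1) * n : ℕ) := by
  suffices h : ∀ A n, n < Mprod m A →
      ∫⁻ x, ‖dirichletSum m n x‖ₑ ∂μ ≤ ((3 * B + 1) * n : ℕ) from h n n (lt_Mprod m hm n)
  intro A
  induction A with
  | zero =>
    intro n hn
    obtain rfl : n = 0 := by simpa [Mprod] using hn
    simp [dirichletSum]
  | succ A ih =>
    intro n hn
    have hM := one_le_Mprod m hm A
    obtain ⟨t, k, ht, hk, rfl⟩ : ∃ t k, t < m A ∧ k < Mprod m A ∧ n = t * Mprod m A + k :=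
      ⟨n / Mprod m A, n % Mprod m A, Nat.div_lt_of_lt_mul (by rwa [mul_comm]),
        Nat.mod_lt _ hM, (Nat.div_add_mod' n _).symm⟩
    have hD := (measurable_Dker m (Mprod m A)).enorm
    have hS := (measurable_dirichletSum m (Mprod m A)).enorm
    calc ∫⁻ x, ‖dirichletSum m (t * Mprod m A + k) x‖ₑ ∂μ
        ≤ ∫⁻ x, ((Mprod m A * (t * t) + k * t : ℕ) * ‖Dker m (Mprod m A) x‖ₑ
            + (t * ‖dirichletSum m (Mprod m A) x‖ₑ + ‖dirichletSum m k x‖ₑ)) ∂μ :=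
          lintegral_mono fun x => enorm_dirichletSum_block_le m hm ht hk.le x
      _ = (Mprod m A * (t * t) + k * t : ℕ) * ∫⁻ x, ‖Dker m (Mprod m A) x‖ₑ ∂μ
            + (t * ∫⁻ x, ‖dirichletSum m (Mprod m A) x‖ₑ ∂μ
              + ∫⁻ x, ‖dirichletSum m k x‖ₑ ∂μ) := by
          rw [lintegral_add_left (hD.const_mul _), lintegral_add_left (hS.const_mul _),
            lintegral_const_mul _ hD, lintegral_const_mul _ hS]
      _ ≤ (Mprod m A * (t * t) + k * t : ℕ) * 1
            + (t * (2 * B * Mprod m A : ℕ) + ((3 * B + 1) * k : ℕ)) := by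
          gcongr
          · exact lintegral_enorm_Dker_Mprod_le m hm hμ A
          · exact lintegral_enorm_dirichletSum_Mprod_le m hm hB hμ A
          · exact ih k hk
      _ = (Mprod m A * (t * t) + k * t + (t * (2 * B * Mprod m A) + (3 * B + 1) * k) : ℕ) := by
          push_cast; ring
      _ ≤ ((3 * B + 1) * (t * Mprod m A + k) : ℕ) := by
          refine Nat.cast_le.mpr ?_
          have h₁ : t * t ≤ B * t := Nat.mul_le_mul_right t (ht.le.trans (hB A))
          have h₂ : k * t ≤ Mprod m A * t := Nat.mul_le_mul_right t hk.le
          have h₃ := Nat.mul_le_mul_left (Mprod m A) h₁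
          linarith

/-- The Vilenkin-Fejér kernels are uniformly bounded in `L¹`:
`sup_{n ≥ 1} ∫ |K_n| dμ ≤ c`. -/
theorem fejer_kernel_L1_bound
    (m : ℕ → ℕ) (hm : ∀ n, 2 ≤ m n) (hbdd : ∃ B, ∀ n, m n ≤ B)
    (μ : Measure (G m)) (hμ : IsVilenkinMeasure m μ) :
    ∃ c : ℝ≥0, 0 < c ∧
      ∀ n : ℕ, 1 ≤ n → (∫⁻ x, (‖Kker m n x‖₊ : ℝ≥0∞) ∂μ) ≤ (c : ℝ≥0∞) := by
  obtain ⟨B, hB⟩ := hbdd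
  refine ⟨((3 * B + 1 : ℕ) : ℝ≥0), by positivity, fun n hn => ?_⟩
  have hn0 : (n : ℝ≥0∞) ≠ 0 := by exact_mod_cast (by omega : n ≠ 0)
  have hK : ∀ x, (‖Kker m n x‖₊ : ℝ≥0∞) = (n : ℝ≥0∞)⁻¹ * ‖dirichletSum m n x‖ₑ := fun x => by
    rw [← enorm_eq_nnnorm, Kker, enorm_mul, enorm_inv (by exact_mod_cast hn0),
      ← ofReal_norm (n : ℂ), Complex.norm_natCast, ENNReal.ofReal_natCast, dirichletSum]
  simp only [hK]
  rw [lintegral_const_mul _ (measurable_dirichletSum m n).enorm]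
  calc (n : ℝ≥0∞)⁻¹ * ∫⁻ x, ‖dirichletSum m n x‖ₑ ∂μ
      ≤ (n : ℝ≥0∞)⁻¹ * ((3 * B + 1) * n : ℕ) := by
        gcongr
        exact lintegral_enorm_dirichletSum_le m hm hB hμ n
    _ = (((3 * B + 1 : ℕ) : ℝ≥0) : ℝ≥0∞) := by
        rw [mul_comm, Nat.cast_mul, mul_assoc,
          ENNReal.mul_inv_cancel hn0 (ENNReal.natCast_ne_top n), mul_one, ENNReal.coe_natCast]

end Vilenkin
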